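/- arXiv:1503.07562 — 3 statements merged into one kernel-verified Lean document; each statement's English description precedes it below -/
import Mathlib

section
/- Let V be a 6-dimensional real vector space with a complex structure J and a compatible symplectic form ω (i.e. ω(J·,J·)=ω and ω(·,J·) positive definite). Let v be a nonzero covector, V₀ a vector, and suppose τ is a real (1,1)-form (with respect to J) satisfying τ∧ω² = 0, τ∧v∧ω = 0, and τ∧v∧Jv = 0, where Jv denotes the covector v∘J⁻¹. Then τ = 0. -/
/-- The wedge product of two real-multilinear alternating forms with values in a
commutative `ℝ`-algebra. -/
noncomputable def wedge {V A : Type*} [AddCommGroup V] [Module ℝ V] [CommRing A] [Algebra ℝ A]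
    {m n : ℕ} (σ : V [⋀^Fin m]→ₗ[ℝ] A) (τ : V [⋀^Fin n]→ₗ[ℝ] A) : V [⋀^Fin (m + n)]→ₗ[ℝ] A :=
  ((LinearMap.mul' ℝ A).compAlternatingMap (σ.domCoprod τ)).domDomCongr finSumFinEquiv

open Equiv in
theorem factorial_mul_wedge_apply {V : Type*} [AddCommGroup V] [Module ℝ V] {m n : ℕ}
    (σ : V [⋀^Fin m]→ₗ[ℝ] ℝ) (τ : V [⋀^Fin n]→ₗ[ℝ] ℝ) (x : Fin (m + n) → V) :
    (m.factorial * n.factorial : ℝ) * wedge σ τ x =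
      ∑ π : Perm (Fin (m + n)), ((Perm.sign π : ℤ) : ℝ) *
        (σ (fun i => x (π (Fin.castAdd n i))) * τ (fun j => x (π (Fin.natAdd m j)))) := by
  have h := congrArg (fun f => LinearMap.mul' ℝ ℝ (f fun i => x (finSumFinEquiv i)))
    (MultilinearMap.domCoprod_alternization_eq σ τ)
  simp only [MultilinearMap.alternatization_apply, AlternatingMap.smul_apply, Fintype.card_fin,
    map_sum, map_nsmul] at h
  rw [nsmul_eq_mul, Nat.cast_mul] at h
  refine h.symm.trans ?_
  refine Fintype.sum_equiv finSumFinEquiv.permCongr _ _ fun π => ?_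
  simp [Units.smul_def, MultilinearMap.domCoprod_apply, ← zsmul_eq_mul, map_zsmul]

/-- The signed sum of `F` over all reorderings of `x`. -/
noncomputable def permSum {V : Type*} {n : ℕ} (F : (Fin n → V) → ℝ) (x : Fin n → V) : ℝ :=
  ∑ π : Equiv.Perm (Fin n), ((Equiv.Perm.sign π : ℤ) : ℝ) * F (x ∘ π)

theorem permSum_succ {V : Type*} {n : ℕ} (F : (Fin (n + 1) → V) → ℝ) (x : Fin (n + 1) → V) :
    permSum F x = ∑ i, (if i = 0 then 1 else -1) *
      permSum (fun y => F (Fin.cons (x i) y)) (fun k => x (Equiv.swap 0 i k.succ)) := by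
  unfold permSum
  rw [← Equiv.Perm.decomposeFin.symm.sum_comp, Fintype.sum_prod_type]
  refine Finset.sum_congr rfl fun i _ => ?_
  rw [Finset.mul_sum]
  refine Finset.sum_congr rfl fun e _ => ?_
  rw [Equiv.Perm.decomposeFin.symm_sign, ← mul_assoc]
  congr 1
  · split_ifs <;> simp
  · congr 1
    ext k
    refine Fin.cases ?_ (fun k => ?_) k <;> simp

theorem permSum_alternating {V : Type*} [AddCommGroup V] [Module ℝ V] {n : ℕ}
    (c : ℝ) (σ : V [⋀^Fin n]→ₗ[ℝ] ℝ) (x : Fin n → V) :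
    permSum (fun y => c * σ y) x = n.factorial * (c * σ x) := by
  unfold permSum
  have h (π : Equiv.Perm (Fin n)) : ((Equiv.Perm.sign π : ℤ) : ℝ) * (c * σ (x ∘ π)) = c * σ x := by
    rw [σ.map_perm]
    rcases Int.units_eq_one_or (Equiv.Perm.sign π) with h | h <;> simp [h]
  simp [h, Fintype.card_perm]

theorem permSum_cast {V : Type*} {m n : ℕ} (h : m = n) (F : (Fin m → V) → ℝ) (x : Fin n → V) :
    permSum F (x ∘ Fin.cast h) = permSum (fun y => F (y ∘ Fin.cast h)) x := by
  subst h
  rfl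

theorem wedge_one_apply {V : Type*} [AddCommGroup V] [Module ℝ V] {n : ℕ}
    (v : V →ₗ[ℝ] ℝ) (σ : V [⋀^Fin n]→ₗ[ℝ] ℝ) (x : Fin (n + 1) → V) :
    wedge ((AlternatingMap.ofSubsingleton ℝ V ℝ (0 : Fin 1)) v) σ
        (x ∘ Fin.cast (Nat.add_comm 1 n)) =
      ∑ i, (if i = 0 then 1 else -1) * (v (x i) * σ (fun k => x (Equiv.swap 0 i k.succ))) := by
  have h := factorial_mul_wedge_apply ((AlternatingMap.ofSubsingleton ℝ V ℝ (0 : Fin 1)) v) σ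
    (x ∘ Fin.cast (Nat.add_comm 1 n))
  have h' := (permSum_cast (Nat.add_comm 1 n) (fun y : Fin (1 + n) → V =>
    (AlternatingMap.ofSubsingleton ℝ V ℝ (0 : Fin 1)) v (fun i => y (Fin.castAdd n i)) *
      σ (fun j => y (Fin.natAdd 1 j))) x).symm.trans h.symm
  have hc (i : Fin n) : Fin.cast (Nat.add_comm 1 n) (Fin.natAdd 1 i) = i.succ := by
    ext; simp
  have hc0 : Fin.cast (Nat.add_comm 1 n) (Fin.castAdd n 0) = 0 := rfl
  simp only [permSum_succ, Function.comp_apply, AlternatingMap.ofSubsingleton_apply_apply, hc, hc0,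
    Fin.cons_zero, Fin.cons_succ, permSum_alternating] at h'
  have hn : (n.factorial : ℝ) ≠ 0 := by positivity
  refine mul_left_cancel₀ hn ?_
  simp only [Nat.factorial_one, Nat.cast_one, one_mul] at h'
  rw [← h', Finset.mul_sum]
  exact Finset.sum_congr rfl fun i _ => by ring

theorem wedge_two_apply {V : Type*} [AddCommGroup V] [Module ℝ V] {n : ℕ}
    (τ : V [⋀^Fin 2]→ₗ[ℝ] ℝ) (σ : V [⋀^Fin n]→ₗ[ℝ] ℝ) (x : Fin (n + 2) → V) :
    2 * wedge τ σ (x ∘ Fin.cast (Nat.add_comm 2 n)) =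
      ∑ i, ∑ j, (if i = 0 then 1 else -1) * ((if j = 0 then 1 else -1) *
        (τ ![x i, x (Equiv.swap 0 i (Fin.succ j))] *
          σ (fun k => x (Equiv.swap 0 i (Fin.succ (Equiv.swap 0 j (Fin.succ k))))))) := by
  have h := factorial_mul_wedge_apply τ σ (x ∘ Fin.cast (Nat.add_comm 2 n))
  have h' := (permSum_cast (Nat.add_comm 2 n) (fun y : Fin (2 + n) → V =>
    τ (fun i => y (Fin.castAdd n i)) * σ (fun j => y (Fin.natAdd 2 j))) x).symm.trans h.symm
  have hc (i : Fin n) : Fin.cast (Nat.add_comm 2 n) (Fin.natAdd 2 i) = i.succ.succ := by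
    ext; simp only [Fin.val_cast, Fin.val_natAdd, Fin.val_succ]; omega
  have hc0 (y : Fin (n + 2) → V) :
      (fun i : Fin 2 => y (Fin.cast (Nat.add_comm 2 n) (Fin.castAdd n i))) = ![y 0, y 1] := by
    ext i
    fin_cases i <;> rfl
  have h1 (a b : V) (y : Fin n → V) : (Fin.cons a (Fin.cons b y) : Fin (n + 2) → V) 1 = b := rfl
  simp only [permSum_succ, Function.comp_apply, hc, hc0, h1, Fin.cons_zero, Fin.cons_succ,
    permSum_alternating] at h'
  have hn : (n.factorial : ℝ) ≠ 0 := by positivity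
  refine mul_left_cancel₀ hn ?_
  simp only [Nat.factorial_two, Nat.cast_ofNat] at h'
  rw [mul_left_comm, ← mul_assoc, ← h', Finset.mul_sum]
  refine Finset.sum_congr rfl fun i _ => ?_
  rw [Finset.mul_sum, Finset.mul_sum]
  exact Finset.sum_congr rfl fun j _ => by ring

theorem wedge_one_one_apply {V : Type*} [AddCommGroup V] [Module ℝ V] (v w : V →ₗ[ℝ] ℝ) (a b : V) :
    wedge ((AlternatingMap.ofSubsingleton ℝ V ℝ (0 : Fin 1)) v)
        ((AlternatingMap.ofSubsingleton ℝ V ℝ (0 : Fin 1)) w) ![a, b] = v a * w b - v b * w a := by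
  have h := wedge_one_apply v ((AlternatingMap.ofSubsingleton ℝ V ℝ (0 : Fin 1)) w) ![a, b]
  simp only [Fin.sum_univ_succ, Equiv.swap_apply_def] at h
  simp at h
  refine Eq.trans ?_ (h.trans ?_)
  · rfl
  · ring

theorem AlternatingMap.map_vec_two_swap {V : Type*} [AddCommGroup V] [Module ℝ V]
    (τ : V [⋀^Fin 2]→ₗ[ℝ] ℝ) (a b : V) : τ ![b, a] = -τ ![a, b] := by
  rw [← τ.map_swap ![a, b] (i := 0) (j := 1) (by decide)]
  congr 1
  ext i
  fin_cases i <;> rfl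

theorem wedge_one_two_apply {V : Type*} [AddCommGroup V] [Module ℝ V]
    (v : V →ₗ[ℝ] ℝ) (σ : V [⋀^Fin 2]→ₗ[ℝ] ℝ) (a b c : V) :
    wedge ((AlternatingMap.ofSubsingleton ℝ V ℝ (0 : Fin 1)) v) σ ![a, b, c] =
      v a * σ ![b, c] - v b * σ ![a, c] + v c * σ ![a, b] := by
  have h := wedge_one_apply v σ ![a, b, c]
  have e (x : Fin 2 → V) : σ x = σ ![x 0, x 1] := by congr 1; ext i; fin_cases i <;> rfl
  simp [Fin.sum_univ_succ, e, Equiv.swap_apply_def] at h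
  simp only [Matrix.cons_val] at h
  refine Eq.trans ?_ (h.trans ?_)
  · rfl
  · rw [σ.map_vec_two_swap a b]
    ring

theorem wedge_two_two_apply {V : Type*} [AddCommGroup V] [Module ℝ V]
    (τ σ : V [⋀^Fin 2]→ₗ[ℝ] ℝ) (a b c d : V) :
    wedge τ σ ![a, b, c, d] = τ ![a, b] * σ ![c, d] - τ ![a, c] * σ ![b, d] +
      τ ![a, d] * σ ![b, c] + τ ![b, c] * σ ![a, d] - τ ![b, d] * σ ![a, c] +
      τ ![c, d] * σ ![a, b] := by
  have h := wedge_two_apply τ σ ![a, b, c, d]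
  have e (x : Fin 2 → V) : σ x = σ ![x 0, x 1] := by congr 1; ext i; fin_cases i <;> rfl
  simp [Fin.sum_univ_succ, e, Equiv.swap_apply_def] at h
  simp only [Matrix.cons_val] at h
  refine mul_left_cancel₀ two_ne_zero (Eq.trans ?_ (h.trans ?_))
  · rfl
  · rw [σ.map_vec_two_swap b c, σ.map_vec_two_swap a c, σ.map_vec_two_swap a b,
      τ.map_vec_two_swap a b, τ.map_vec_two_swap a c, τ.map_vec_two_swap a d,
      τ.map_vec_two_swap b c, τ.map_vec_two_swap b d, τ.map_vec_two_swap c d]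
    ring

set_option maxRecDepth 10000 in
theorem wedge_two_one_two_apply {V : Type*} [AddCommGroup V] [Module ℝ V]
    (τ ω : V [⋀^Fin 2]→ₗ[ℝ] ℝ) (v : V →ₗ[ℝ] ℝ) {p q x y z : V}
    (hp : v p = 0) (hx : v x = 0) (hy : v y = 0) (hz : v z = 0)
    (hxy : τ ![x, y] = 0) (hxz : τ ![x, z] = 0) (hyz : τ ![y, z] = 0)
    (hωy : ω ![x, y] = 0) (hωz : ω ![x, z] = 0) :
    wedge τ (wedge ((AlternatingMap.ofSubsingleton ℝ V ℝ (0 : Fin 1)) v) ω) ![p, x, q, y, z] =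
      τ ![p, x] * (v q * ω ![y, z]) := by
  have h : 2 * wedge τ (wedge ((AlternatingMap.ofSubsingleton ℝ V ℝ (0 : Fin 1)) v) ω)
      ![p, x, q, y, z] = _ := wedge_two_apply τ _ ![p, x, q, y, z]
  have e (s : Fin 3 → V) : wedge ((AlternatingMap.ofSubsingleton ℝ V ℝ (0 : Fin 1)) v) ω s =
      v (s 0) * ω ![s 1, s 2] - v (s 1) * ω ![s 0, s 2] + v (s 2) * ω ![s 0, s 1] := by
    rw [← wedge_one_two_apply]
    congr 1; ext i; fin_cases i <;> rfl
  simp [Fin.sum_univ_succ, e, Equiv.swap_apply_def, hp, hx, hy, hz, hxy, hxz, hyz, hωy, hωz,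
    τ.map_vec_two_swap x y, τ.map_vec_two_swap x z, τ.map_vec_two_swap y z,
    ω.map_vec_two_swap x y, τ.map_vec_two_swap p x] at h
  linarith

set_option maxRecDepth 10000 in
/-- If `τ` pairs trivially with everything outside the plane of `a` and `b`, only one term of the
shuffle sum survives. -/
theorem wedge_two_four_apply {V : Type*} [AddCommGroup V] [Module ℝ V]
    (τ : V [⋀^Fin 2]→ₗ[ℝ] ℝ) (σ : V [⋀^Fin 4]→ₗ[ℝ] ℝ) {a b c d e f : V}
    (hc : ∀ z, τ ![c, z] = 0) (hd : ∀ z, τ ![d, z] = 0) (he : ∀ z, τ ![e, z] = 0)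
    (hf : ∀ z, τ ![f, z] = 0) :
    wedge τ σ ![a, b, c, d, e, f] = τ ![a, b] * σ ![c, d, e, f] := by
  have h : 2 * wedge τ σ ![a, b, c, d, e, f] = _ := wedge_two_apply τ σ ![a, b, c, d, e, f]
  have hr {x : V} (hx : ∀ z, τ ![x, z] = 0) (z : V) : τ ![z, x] = 0 := by
    rw [τ.map_vec_two_swap, hx, neg_zero]
  have e (x : Fin 4 → V) : σ x = σ ![x 0, x 1, x 2, x 3] := by congr 1; ext i; fin_cases i <;> rfl
  simp [Fin.sum_univ_succ, Equiv.swap_apply_def, hc, hd, he, hf, hr hc, hr hd, hr he, hr hf] at h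
  rw [e] at h
  nth_rw 2 [e] at h
  simp [τ.map_vec_two_swap a b] at h
  linarith

/-- Finitely many linear conditions, fewer than the dimension, have a nonzero common solution. -/
theorem exists_ne_zero_forall_eq_zero {V : Type*} [AddCommGroup V] [Module ℝ V]
    [FiniteDimensional ℝ V] {n : ℕ} (f : Fin n → V →ₗ[ℝ] ℝ) (hn : n < Module.finrank ℝ V) :
    ∃ x : V, x ≠ 0 ∧ ∀ i, f i x = 0 := by
  have h : LinearMap.ker (LinearMap.pi f) ≠ ⊥ :=
    LinearMap.ker_ne_bot_of_finrank_lt (by simpa using hn)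
  obtain ⟨x, hx, hx0⟩ := Submodule.exists_mem_ne_zero_of_ne_bot h
  exact ⟨x, hx0, fun i => congrFun (LinearMap.mem_ker.mp hx) i⟩

set_option maxRecDepth 10000 in
/-- on a 6-dimensional real vector space with a complex structure `J` and a
compatible positive `(1,1)`-form `ω`, if a real `(1,1)`-form `τ` satisfies
`τ∧ω² = 0`, `τ∧v∧ω = 0` and `τ∧v∧Jv = 0` for a nonzero covector `v`, then `τ = 0`. -/
theorem statement0
    (V : Type*) [AddCommGroup V] [Module ℝ V] [FiniteDimensional ℝ V]
    (hdim : Module.finrank ℝ V = 6)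
    (J : V →ₗ[ℝ] V) (hJ : ∀ x, J (J x) = -x)
    (ω : V [⋀^Fin 2]→ₗ[ℝ] ℝ)
    (hωJ : ∀ x y, ω ![J x, J y] = ω ![x, y])
    (hωpos : ∀ x : V, x ≠ 0 → 0 < ω ![x, J x])
    (v : V →ₗ[ℝ] ℝ) (hv : v ≠ 0)
    (V₀ : V)
    (τ : V [⋀^Fin 2]→ₗ[ℝ] ℝ)
    (hτ11 : ∀ x y, τ ![J x, J y] = τ ![x, y])
    (h1 : wedge τ (wedge ω ω) = 0)
    (h2 : wedge τ (wedge ((AlternatingMap.ofSubsingleton ℝ V ℝ (0 : Fin 1)) v) ω) = 0)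
    (h3 : wedge τ (wedge ((AlternatingMap.ofSubsingleton ℝ V ℝ (0 : Fin 1)) v)
        ((AlternatingMap.ofSubsingleton ℝ V ℝ (0 : Fin 1)) (-(v.comp J)))) = 0) :
    τ = 0 := by
  obtain ⟨p, hp, hpJ⟩ : ∃ p, v p ≠ 0 ∧ v (J p) = 0 := by
    obtain ⟨u, hu⟩ : ∃ u, v u ≠ 0 := by
      by_contra! h
      exact hv (LinearMap.ext h)
    refine ⟨v u • u + v (J u) • J u, ?_, ?_⟩
    · simp only [map_add, map_smul, smul_eq_mul]
      have : 0 < v u * v u := mul_self_pos.mpr hu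
      nlinarith [mul_self_nonneg (v (J u))]
    · simp only [map_add, map_smul, smul_eq_mul, hJ, map_neg]
      ring
  have hupd (x y z : V) : Function.update ![x, z] 0 y = ![y, z] := by
    ext i
    fin_cases i <;> rfl
  have hadd (x y z : V) : τ ![x + y, z] = τ ![x, z] + τ ![y, z] := by
    simpa only [hupd] using τ.map_update_add ![x, z] 0 x y
  have hsmul (c : ℝ) (x z : V) : τ ![c • x, z] = c * τ ![x, z] := by
    simpa only [hupd, smul_eq_mul] using τ.map_update_smul ![x, z] 0 c x
  let ω' (x : V) : V →ₗ[ℝ] ℝ := ω.toMultilinearMap.toLinearMap ![x, 0] 1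
  have hω' (x y : V) : ω' x y = ω ![x, y] := by
    change ω (Function.update ![x, 0] 1 y) = _
    congr 1
    ext i
    fin_cases i <;> rfl
  have hneg (x y : V) : ω ![x, -y] = -ω ![x, y] := by
    rw [← hω', ← hω', map_neg]
  have hself (σ : V [⋀^Fin 2]→ₗ[ℝ] ℝ) (x : V) : σ ![x, x] = 0 :=
    σ.map_eq_zero_of_eq _ (i := 0) (j := 1) rfl (by decide)
  -- `τ` vanishes on the complex hyperplane `ker v ∩ ker (v ∘ J)`
  have hW (x y : V) (hx : v x = 0) (hxJ : v (J x) = 0) (hy : v y = 0) (hyJ : v (J y) = 0) :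
      τ ![x, y] = 0 := by
    have h := congrArg (fun f => f ![x, y, p, J p]) h3
    simp only [AlternatingMap.zero_apply] at h
    erw [wedge_two_two_apply] at h
    simp only [wedge_one_one_apply] at h
    simpa [hx, hxJ, hy, hyJ, hpJ, hJ, hp] using h
  have hJp (x : V) (hx : v x = 0) (hxJ : v (J x) = 0) : τ ![J p, x] = 0 := by
    obtain ⟨y, hy0, hy⟩ := exists_ne_zero_forall_eq_zero ![v, v ∘ₗ J, ω' x, ω' x ∘ₗ J]
      (by rw [hdim]; norm_num)
    have hy1 : v y = 0 := hy 0
    have hy2 : v (J y) = 0 := hy 1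
    have hy3 : ω ![x, y] = 0 := (hω' x y).symm.trans (hy 2)
    have hy4 : ω ![x, J y] = 0 := (hω' x (J y)).symm.trans (hy 3)
    have hy5 : v (J (J y)) = 0 := by simp [hJ, hy1]
    have h := congrArg (fun f => f ![J p, x, p, y, J y]) h2
    have h' := (wedge_two_one_two_apply τ ω v (q := p) hpJ hx hy1 hy2 (hW x y hx hxJ hy1 hy2)
      (hW x (J y) hx hxJ hy2 hy5) (hW y (J y) hy1 hy2 hy2 hy5) hy3 hy4).symm.trans h
    simpa [hp, (hωpos y hy0).ne'] using h'
  have hp' (x : V) (hx : v x = 0) (hxJ : v (J x) = 0) : τ ![p, x] = 0 := by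
    rw [← hτ11]
    exact hJp _ hxJ (by simp [hJ, hx])
  have hdecomp (x : V) : ∃ a b : ℝ, ∃ w, v w = 0 ∧ v (J w) = 0 ∧ x = a • p + (b • J p + w) := by
    refine ⟨v x / v p, -(v (J x) / v p), x - (v x / v p) • p + (v (J x) / v p) • J p, ?_, ?_, ?_⟩
    · simp [hpJ, hp]
    · simp [hpJ, hp, hJ]
    · module
  have hWz (x : V) (hx : v x = 0) (hxJ : v (J x) = 0) (z : V) : τ ![x, z] = 0 := by
    obtain ⟨a, b, w, hw, hwJ, rfl⟩ := hdecomp z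
    rw [τ.map_vec_two_swap, hadd, hadd, hsmul, hsmul, hp' x hx hxJ, hJp x hx hxJ,
      hW w x hw hwJ hx hxJ]
    simp
  have hpp : τ ![p, J p] = 0 := by
    obtain ⟨x, hx0, hx⟩ := exists_ne_zero_forall_eq_zero ![v, v ∘ₗ J] (by rw [hdim]; norm_num)
    have hx1 : v x = 0 := hx 0
    have hx2 : v (J x) = 0 := hx 1
    obtain ⟨y, hy0, hy⟩ := exists_ne_zero_forall_eq_zero ![v, v ∘ₗ J, ω' x, ω' x ∘ₗ J]
      (by rw [hdim]; norm_num)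
    have hy1 : v y = 0 := hy 0
    have hy2 : v (J y) = 0 := hy 1
    have hy3 : ω ![x, y] = 0 := (hω' x y).symm.trans (hy 2)
    have hy4 : ω ![x, J y] = 0 := (hω' x (J y)).symm.trans (hy 3)
    have hy5 : ω ![J x, J y] = 0 := by rw [hωJ, hy3]
    have hy6 : ω ![J x, y] = 0 := by
      rw [← hωJ, hJ, ω.map_vec_two_swap, hneg, neg_neg, ω.map_vec_two_swap, hy4, neg_zero]
    have h := congrArg (fun f => f ![p, J p, x, J x, y, J y]) h1
    have h' := (wedge_two_four_apply τ (wedge ω ω) (hWz x hx1 hx2)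
      (hWz (J x) hx2 (by simp [hJ, hx1])) (hWz y hy1 hy2)
      (hWz (J y) hy2 (by simp [hJ, hy1]))).symm.trans h
    rw [wedge_two_two_apply] at h'
    have hxy := mul_pos (hωpos x hx0) (hωpos y hy0)
    refine (mul_eq_zero.mp h').resolve_right ?_
    rw [hy3, hy4, hy5, hy6]
    nlinarith
  have hτ (x z : V) : τ ![x, z] = 0 := by
    obtain ⟨a, b, w, hw, hwJ, rfl⟩ := hdecomp x
    obtain ⟨c, d, w', hw', hwJ', rfl⟩ := hdecomp z
    rw [hadd, hadd, hsmul, hsmul, hWz w hw hwJ, τ.map_vec_two_swap _ p, τ.map_vec_two_swap _ (J p)]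
    simp only [hadd, hsmul, hWz w' hw' hwJ', hself, hpp, τ.map_vec_two_swap p (J p)]
    simp
  ext s
  have hs : s = ![s 0, s 1] := by ext i; fin_cases i <;> rfl
  rw [hs]
  exact hτ _ _
end

section
/- Consider ℝ⁶ with complex structure J and a nonzero covector v, and let V be a vector, r an element of a Lie algebra with invariant pairing. The symbol-exactness statement: if Ω is a decomposable nonvanishing (3,0)-form on (ℝ⁶,J) and α ∈ Λ^{3,0} ⊕ Λ^{2,1} satisfies v ∧ α = 0 for a nonzero covector v, then there exists a (1,0)-vector V with α = v ∧ ι_V Ω. (Exactness of the symbol sequence of the Calabi–Yau deformation complex at the first step.) -/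
namespace Statement9

variable {V : Type*} [AddCommGroup V] [Module ℝ V]

/-- Wedge product of complexified forms (real-multilinear alternating maps with values
in `ℂ`). -/
noncomputable def wedgeC {m n : ℕ} (σ : V [⋀^Fin m]→ₗ[ℝ] ℂ) (τ : V [⋀^Fin n]→ₗ[ℝ] ℂ) :
    V [⋀^Fin (m + n)]→ₗ[ℝ] ℂ :=
  ((LinearMap.mul' ℝ ℂ).compAlternatingMap (σ.domCoprod τ)).domDomCongr finSumFinEquiv

/-- A real form viewed as a complexified form. -/
noncomputable def toC {n : ℕ} (σ : V [⋀^Fin n]→ₗ[ℝ] ℝ) : V [⋀^Fin n]→ₗ[ℝ] ℂ :=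
  Complex.ofRealAm.toLinearMap.compAlternatingMap σ

/-- Contraction of a complexified form with the `(0,1)`-vector `x + iJx`. -/
noncomputable def contr01 (J : V →ₗ[ℝ] V) {n : ℕ} (β : V [⋀^Fin (n + 1)]→ₗ[ℝ] ℂ) (x : V) :
    V [⋀^Fin n]→ₗ[ℝ] ℂ :=
  β.curryLeft x + Complex.I • β.curryLeft (J x)

section Wedge

open Equiv TensorProduct

variable {R M N₁ N₂ : Type*} [CommRing R] [AddCommGroup M] [Module R M]
  [AddCommGroup N₁] [Module R N₁] [AddCommGroup N₂] [Module R N₂]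

/-- The shuffle of `Fin 1 ⊕ Fin n` which moves the first index to position `p` and keeps the order
of the others. -/
def shuffle {n : ℕ} (e : Fin 1 ⊕ Fin n ≃ Fin (n + 1)) (p : Fin (n + 1)) : Perm (Fin 1 ⊕ Fin n) :=
  e.symm.permCongr p.cycleRange.symm

theorem bijective_mk_shuffle {n : ℕ} (e : Fin 1 ⊕ Fin n ≃ Fin (n + 1))
    (he : e (Sum.inl 0) = 0) :
    Function.Bijective
      (fun p => (Quotient.mk'' (shuffle e p) : Perm.ModSumCongr (Fin 1) (Fin n))) := by
  have hs (p) : shuffle e p (Sum.inl 0) = e.symm p := by simp [shuffle, permCongr_apply, he]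
  constructor
  · intro p q hpq
    rw [Quotient.eq'', QuotientGroup.leftRel_apply] at hpq
    obtain ⟨⟨σ, τ⟩, h⟩ := hpq
    have h' := congrArg (fun ρ : Perm (Fin 1 ⊕ Fin n) => ρ (Sum.inl 0)) h
    simp only [Perm.sumCongrHom_apply, Perm.sumCongr_apply, Sum.map_inl, Perm.mul_apply,
      Subsingleton.elim (σ 0) 0, Perm.eq_inv_iff_eq, hs] at h'
    exact e.symm.injective h'
  · intro σ
    induction σ using Quotient.inductionOn' with | _ σ
    refine ⟨e (σ (Sum.inl 0)), ?_⟩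
    rw [Quotient.eq'', QuotientGroup.leftRel_apply]
    apply Perm.mem_sumCongrHom_range_of_perm_mapsTo_inl
    rintro _ ⟨i, rfl⟩
    refine ⟨0, ?_⟩
    rw [Perm.mul_apply, Perm.eq_inv_iff_eq, hs, symm_apply_apply, Subsingleton.elim i 0]

theorem domCoprod_fin_one_apply {n : ℕ} (e : Fin 1 ⊕ Fin n ≃ Fin (n + 1))
    (he₀ : e (Sum.inl 0) = 0) (he : ∀ j, e (Sum.inr j) = j.succ)
    (a : M [⋀^Fin 1]→ₗ[R] N₁) (b : M [⋀^Fin n]→ₗ[R] N₂) (x : Fin (n + 1) → M) :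
    a.domCoprod b (x ∘ e) =
      ∑ p : Fin (n + 1), (-1 : ℤ) ^ (p : ℕ) • (a (fun _ => x p) ⊗ₜ[R] b (p.removeNth x)) := by
  change (∑ σ, AlternatingMap.domCoprod.summand a b σ) (x ∘ e) = _
  rw [sum_apply]
  symm
  refine Fintype.sum_bijective _ (bijective_mk_shuffle e he₀) _ _ fun p => ?_
  have hsign : Perm.sign (shuffle e p) = (-1) ^ (p : ℕ) := by simp [shuffle]
  have hl : (fun i : Fin 1 => e (shuffle e p (Sum.inl i))) = fun _ => p := by
    funext i
    simp [shuffle, permCongr_apply, Subsingleton.elim i 0, he₀]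
  have hr (j) : e (shuffle e p (Sum.inr j)) = p.succAbove j := by
    simp [shuffle, permCongr_apply, he]
  change _ = AlternatingMap.domCoprod.summand a b (Quotient.mk'' (shuffle e p)) (x ∘ e)
  rw [AlternatingMap.domCoprod.summand_mk'', hsign]
  simp only [smul_apply, MultilinearMap.domDomCongr_apply, MultilinearMap.domCoprod_apply,
    Function.comp_apply, hr, AlternatingMap.coe_multilinearMap]
  have hx : (fun i : Fin 1 => x (e (shuffle e p (Sum.inl i)))) = fun _ => x p :=
    funext fun i => congrArg x (congrFun hl i)
  rw [hx, Units.smul_def]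
  simp only [Units.val_pow_eq_pow_val, Units.val_neg, Units.val_one]
  rfl

end Wedge

theorem wedgeC_covector_apply {n : ℕ} (v : V →ₗ[ℝ] ℝ) (τ : V [⋀^Fin n]→ₗ[ℝ] ℂ)
    (x : Fin (n + 1) → V) :
    wedgeC (toC ((AlternatingMap.ofSubsingleton ℝ V ℝ (0 : Fin 1)) v)) τ
      (x ∘ Fin.cast (Nat.add_comm 1 n)) =
      ∑ p : Fin (n + 1), (-1 : ℂ) ^ (p : ℕ) * (v (x p) * τ (p.removeNth x)) := by
  have h := domCoprod_fin_one_apply (finSumFinEquiv.trans (finCongr (Nat.add_comm 1 n)))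
    (by ext; simp) (by intro j; ext; simp)
    (toC ((AlternatingMap.ofSubsingleton ℝ V ℝ (0 : Fin 1)) v)) τ x
  have h' := congrArg (LinearMap.mul' ℝ ℂ) h
  rw [map_sum] at h'
  refine Eq.trans ?_ (h'.trans (Finset.sum_congr rfl fun p _ => ?_))
  · rfl
  · rw [map_zsmul, zsmul_eq_mul]
    simp [toC]

/-- In complex dimension 3, contraction of vectors with a nonzero volume form is onto the 2-forms. -/
theorem exists_curryLeft_eq {W : Type*} [AddCommGroup W] [Module ℂ W]
    (hW : Module.finrank ℂ W = 3) (Ω : W [⋀^Fin 3]→ₗ[ℂ] ℂ) (hΩ : Ω ≠ 0)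
    (γ : W [⋀^Fin 2]→ₗ[ℂ] ℂ) : ∃ x, Ω.curryLeft x = γ := by
  have : FiniteDimensional ℂ W := Module.finite_of_finrank_eq_succ hW
  let b := Module.finBasisOfFinrankEq ℂ W hW
  have hω : Ω ![b 0, b 1, b 2] ≠ 0 := by
    have := (AlternatingMap.map_basis_ne_zero_iff b Ω).2 hΩ
    convert this using 2
    funext i; fin_cases i <;> rfl
  have hsw (f : W [⋀^Fin 2]→ₗ[ℂ] ℂ) (y z) : f ![y, z] = -f ![z, y] := by
    rw [← f.map_swap ![z, y] (show (0 : Fin 2) ≠ 1 by decide)]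
    congr 1; funext i; fin_cases i <;> rfl
  have hrot (y z w) : Ω ![y, z, w] = Ω ![z, w, y] := by
    rw [← neg_neg (Ω ![z, w, y]), ← Ω.map_swap ![z, w, y] (show (0 : Fin 3) ≠ 1 by decide),
      ← Ω.map_swap _ (show (0 : Fin 3) ≠ 2 by decide)]
    congr 1; funext i; fin_cases i <;> rfl
  have hself (y z) : Ω ![y, y, z] = 0 :=
    Ω.map_eq_zero_of_eq _ (show ![y, y, z] 0 = ![y, y, z] 1 from rfl) (by decide)
  have hself₁ (y z) : Ω ![y, z, z] = 0 := by rw [hrot, hself]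
  have hself₂ (y z) : Ω ![y, z, y] = 0 := by rw [hrot, hself₁]
  have hsw₃ (y z w) : Ω ![y, z, w] = -Ω ![y, w, z] := by
    rw [← Ω.map_swap ![y, w, z] (show (1 : Fin 3) ≠ 2 by decide)]
    congr 1; funext i; fin_cases i <;> rfl
  have hself' (y) : γ ![y, y] = 0 :=
    γ.map_eq_zero_of_eq _ (show ![y, y] 0 = ![y, y] 1 from rfl) (by decide)
  refine ⟨(Ω ![b 0, b 1, b 2])⁻¹ •
    (γ ![b 1, b 2] • b 0 + γ ![b 2, b 0] • b 1 + γ ![b 0, b 1] • b 2), ?_⟩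
  refine b.ext_alternating fun w _ => ?_
  have hw : (fun i => b (w i)) = ![b (w 0), b (w 1)] := by
    funext i; fin_cases i <;> rfl
  rw [hw]
  generalize w 0 = i, w 1 = j
  simp only [map_smul, map_add, AlternatingMap.smul_apply, AlternatingMap.add_apply, smul_eq_mul,
    AlternatingMap.curryLeft_apply_apply]
  have h₁ : Ω ![b 1, b 2, b 0] = Ω ![b 0, b 1, b 2] := (hrot _ _ _).symm
  have h₂ : Ω ![b 2, b 0, b 1] = Ω ![b 0, b 1, b 2] := hrot _ _ _
  have h₃ : Ω ![b 0, b 2, b 1] = -Ω ![b 0, b 1, b 2] := hsw₃ _ _ _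
  have h₄ : Ω ![b 2, b 1, b 0] = -Ω ![b 0, b 1, b 2] := by rw [hsw₃, h₂]
  have h₅ : Ω ![b 1, b 0, b 2] = -Ω ![b 0, b 1, b 2] := by rw [hsw₃, h₁]
  fin_cases i <;> fin_cases j <;>
    simp [hself, hself₁, hself₂, hself', h₁, h₂, h₃, h₄, h₅, hsw _ (b 1) (b 0), hsw _ (b 2) (b 1),
      hsw _ (b 0) (b 2)] <;>
    field_simp

/-- A real alternating form which is complex linear in the first argument is complex
multilinear. -/
noncomputable def complexForm {W : Type*} [AddCommGroup W] [Module ℝ W] [Module ℂ W] {n : ℕ}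
    (f : W [⋀^Fin (n + 1)]→ₗ[ℝ] ℂ)
    (hf : ∀ (c : ℂ) (x : W), f.curryLeft (c • x) = c • f.curryLeft x) :
    W [⋀^Fin (n + 1)]→ₗ[ℂ] ℂ where
  toFun := f
  map_update_add' m i x y := f.map_update_add' m i x y
  map_update_smul' {inst} m i c x := by
    obtain rfl : inst = instDecidableEqFin _ := Subsingleton.elim _ _
    have h (z : W) : f (Function.update m i z) =
        (-1 : ℤ) ^ (i : ℕ) • f.curryLeft z (i.removeNth m) := by
      rw [← Fin.insertNth_removeNth, f.map_insertNth]; rfl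
    rw [h, h, hf, AlternatingMap.smul_apply, smul_comm]
  map_eq_zero_of_eq' := f.map_eq_zero_of_eq

theorem exists_curryLeft_eq_of_contr01_eq_zero (hdim : Module.finrank ℝ V = 6)
    (J : V →ₗ[ℝ] V) (hJ : ∀ x, J (J x) = -x)
    (Ω : V [⋀^Fin 3]→ₗ[ℝ] ℂ) (hΩ : Ω ≠ 0) (hΩtype : ∀ x : V, contr01 J Ω x = 0)
    (γ : V [⋀^Fin 2]→ₗ[ℝ] ℂ) (hγtype : ∀ x : V, contr01 J γ x = 0) :
    ∃ x, Ω.curryLeft x = γ := by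
  have hJ' : J * J = -1 := LinearMap.ext hJ
  let : Module ℂ V := Module.compHom V (Complex.lift ⟨J, hJ'⟩ : ℂ →ₐ[ℝ] Module.End ℝ V).toRingHom
  have hsmul (c : ℂ) (x : V) : c • x = c.re • x + c.im • J x := by
    change (Complex.lift ⟨J, hJ'⟩ : ℂ →ₐ[ℝ] Module.End ℝ V) c x = _
    simp [Complex.lift, Complex.liftAux_apply, Module.algebraMap_end_apply]
  have : IsScalarTower ℝ ℂ V := ⟨fun r c x => by simp [hsmul, mul_smul]⟩
  have hfin : Module.finrank ℂ V = 3 := by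
    have := Module.finrank_mul_finrank ℝ ℂ V
    rw [Complex.finrank_real_complex] at this
    omega
  have hlin {n : ℕ} (f : V [⋀^Fin (n + 1)]→ₗ[ℝ] ℂ) (hf : ∀ x, contr01 J f x = 0) (c : ℂ)
      (x : V) : f.curryLeft (c • x) = c • f.curryLeft x := by
    have h := congrArg (Complex.I • ·) (hf x)
    simp only [contr01, smul_add, smul_smul, Complex.I_mul_I, neg_one_smul, smul_zero] at h
    have h' : f.curryLeft (J x) = Complex.I • f.curryLeft x := (add_neg_eq_zero.1 h).symm
    rw [hsmul, map_add, map_smul, map_smul, h']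
    ext m
    simp only [AlternatingMap.add_apply, AlternatingMap.smul_apply, smul_eq_mul,
      Complex.real_smul]
    conv_rhs => rw [← Complex.re_add_im c]
    ring
  obtain ⟨x, hx⟩ := exists_curryLeft_eq hfin (complexForm Ω (hlin Ω hΩtype))
    (fun h => hΩ (AlternatingMap.ext fun m => DFunLike.congr_fun h m))
    (complexForm γ (hlin γ hγtype))
  exact ⟨x, AlternatingMap.ext fun m => DFunLike.congr_fun hx m⟩

/-- A nonzero covector `v` on `(V, J)` takes the value `1` at some `(0,1)`-vector `e + iJe`. -/
theorem exists_apply_eq_one_and_apply_complex_structure_eq_zero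
    (J : V →ₗ[ℝ] V) (hJ : ∀ x, J (J x) = -x) (v : V →ₗ[ℝ] ℝ) (hv : v ≠ 0) :
    ∃ e, v e = 1 ∧ v (J e) = 0 := by
  obtain ⟨w, hw⟩ : ∃ w, v w ≠ 0 := by
    by_contra! h
    exact hv (LinearMap.ext h)
  have hs : v w * v w + v (J w) * v (J w) ≠ 0 :=
    (add_pos_of_pos_of_nonneg (mul_self_pos.2 hw) (mul_self_nonneg _)).ne'
  refine ⟨(v w * v w + v (J w) * v (J w))⁻¹ • (v w • w + v (J w) • J w), ?_, ?_⟩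
  · simpa [mul_add] using inv_mul_cancel₀ hs
  · simp [hJ, mul_comm]

/-- Contracting `v ∧ α = 0` with the `(0,1)`-vector `e + iJe`, at which `v` takes the
value `1`. -/
theorem eq_wedgeC_contr01 (J : V →ₗ[ℝ] V) (α : V [⋀^Fin 3]→ₗ[ℝ] ℂ) (v : V →ₗ[ℝ] ℝ) (e : V)
    (he : v e = 1) (hJe : v (J e) = 0)
    (hvα : wedgeC (toC ((AlternatingMap.ofSubsingleton ℝ V ℝ (0 : Fin 1)) v)) α = 0) :
    α = wedgeC (toC ((AlternatingMap.ofSubsingleton ℝ V ℝ (0 : Fin 1)) v)) (contr01 J α e) := by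
  ext x
  have key (y : V) : (v y : ℂ) * α x = ∑ p : Fin 3,
      (-1 : ℂ) ^ (p : ℕ) * (v (x p) * α.curryLeft y (p.removeNth x)) := by
    have h := wedgeC_covector_apply v α (Fin.cons y x)
    rw [hvα, Fin.sum_univ_succ] at h
    have hcons (p : Fin 3) : p.succ.removeNth (Fin.cons y x : Fin 4 → V) =
        Matrix.vecCons y (p.removeNth x) :=
      Fin.cons_comp_succ_succAbove _ _ _
    simp only [hcons, Fin.cons_zero, Fin.cons_succ, Fin.removeNth_zero, Fin.tail_cons,
      Fin.val_zero, pow_zero, one_mul, Fin.val_succ, pow_succ, mul_neg_one, neg_mul,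
      Finset.sum_neg_distrib] at h
    exact add_neg_eq_zero.1 h.symm
  refine Eq.trans ?_ (wedgeC_covector_apply v (contr01 J α e) x).symm
  have h₁ := key e
  have h₂ := key (J e)
  rw [he, Complex.ofReal_one, one_mul] at h₁
  rw [hJe, Complex.ofReal_zero, zero_mul] at h₂
  calc α x = α x + Complex.I * 0 := by ring
    _ = _ := by
      rw [h₂, h₁, Finset.mul_sum, ← Finset.sum_add_distrib]
      refine Finset.sum_congr rfl fun p _ => ?_
      simp only [contr01, AlternatingMap.add_apply, AlternatingMap.smul_apply, smul_eq_mul]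
      ring

/-- on `(ℝ⁶, J)` with a nonvanishing `(3,0)`-form `Ω` (i.e. `ι_u Ω = 0` for all
`(0,1)`-vectors `u`, which is the condition that `Ω` determines the almost complex structure
`J`), if `α ∈ Λ^{3,0} ⊕ Λ^{2,1}` (i.e. `α` is killed by two `(0,1)`-contractions) satisfies
`v ∧ α = 0` for a nonzero real covector `v`, then `α = v ∧ ι_V Ω` for some `(1,0)`-vector
`V = x − iJx`. -/
theorem statement9
    [FiniteDimensional ℝ V] (hdim : Module.finrank ℝ V = 6)
    (J : V →ₗ[ℝ] V) (hJ : ∀ x, J (J x) = -x)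
    (Ω : V [⋀^Fin 3]→ₗ[ℝ] ℂ) (hΩne : Ω ≠ 0)
    (hΩtype : ∀ x : V, contr01 J Ω x = 0)
    (α : V [⋀^Fin 3]→ₗ[ℝ] ℂ)
    (hαtype : ∀ x y : V, contr01 J (contr01 J α x) y = 0)
    (v : V →ₗ[ℝ] ℝ) (hv : v ≠ 0)
    (hvα : wedgeC (toC ((AlternatingMap.ofSubsingleton ℝ V ℝ (0 : Fin 1)) v)) α = 0) :
    ∃ x : V, α = wedgeC (toC ((AlternatingMap.ofSubsingleton ℝ V ℝ (0 : Fin 1)) v))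
      (Ω.curryLeft x - Complex.I • Ω.curryLeft (J x)) := by
  obtain ⟨e, he, hJe⟩ := exists_apply_eq_one_and_apply_complex_structure_eq_zero J hJ v hv
  obtain ⟨x, hx⟩ := exists_curryLeft_eq_of_contr01_eq_zero hdim J hJ Ω hΩne hΩtype _ (hαtype e)
  refine ⟨(2⁻¹ : ℝ) • x, (eq_wedgeC_contr01 J α v e he hJe hvα).trans ?_⟩
  have hI : Complex.I • Ω.curryLeft (J x) = -Ω.curryLeft x :=
    eq_neg_of_add_eq_zero_right (hΩtype x)
  congr 1
  rw [map_smul, map_smul, map_smul, smul_comm, hI, ← hx, ← smul_sub, sub_neg_eq_add, ← two_smul ℝ,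
    smul_smul]
  norm_num

end Statement9
end

section
/- On a 6-dimensional complex vector space setting: let ω be a positive (1,1)-form, Ω a nonzero (3,0)-form with 6iΩ∧Ω̄ = ‖Ω‖²ω³, v a nonzero real covector, V a vector with Ω̇ = v∧ι_V Ω, and ω̇ a real 2-form. If the variation of ‖Ω‖_ω vanishes (δ(‖Ω‖_ω)=0), then ‖Ω‖² ω̇∧ω² = 2i(Ω̇∧Ω̄ + Ω∧Ω̄̇) = ‖Ω‖² v∧(ι_V ω)∧ω², i.e. ω̇∧ω² = v∧(ι_V ω)∧ω². -/
namespace Statement15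

variable {V : Type*} [AddCommGroup V] [Module ℝ V]

/-- Wedge product of forms with values in a commutative `ℝ`-algebra. -/
noncomputable def wedge {B : Type*} [CommRing B] [Algebra ℝ B] {m n : ℕ}
    (σ : V [⋀^Fin m]→ₗ[ℝ] B) (τ : V [⋀^Fin n]→ₗ[ℝ] B) : V [⋀^Fin (m + n)]→ₗ[ℝ] B :=
  ((LinearMap.mul' ℝ B).compAlternatingMap (σ.domCoprod τ)).domDomCongr finSumFinEquiv

/-- A real form viewed as a complex-valued form. -/
noncomputable def toC {n : ℕ} (σ : V [⋀^Fin n]→ₗ[ℝ] ℝ) : V [⋀^Fin n]→ₗ[ℝ] ℂ :=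
  Complex.ofRealAm.toLinearMap.compAlternatingMap σ

/-- Complex conjugation of a complex-valued form. -/
noncomputable def conjA {n : ℕ} (σ : V [⋀^Fin n]→ₗ[ℝ] ℂ) : V [⋀^Fin n]→ₗ[ℝ] ℂ :=
  Complex.conjAe.toLinearMap.compAlternatingMap σ

section Wedge

open Equiv.Perm Finset

/-- The unnormalised antisymmetrisation of a function of vectors. -/
noncomputable def altSum {ι X B : Type*} [Fintype ι] [DecidableEq ι] [CommRing B]
    (f : (ι → X) → B) (x : ι → X) : B :=
  ∑ π : Equiv.Perm ι, ((sign π : ℤ) : B) * f (x ∘ π)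

theorem altSum_comp_perm {ι X B : Type*} [Fintype ι] [DecidableEq ι] [CommRing B]
    (f : (ι → X) → B) (ρ : Equiv.Perm ι) (x : ι → X) :
    altSum (fun y => f (y ∘ ρ)) x = ((sign ρ : ℤ) : B) * altSum f x := by
  unfold altSum
  rw [mul_sum]
  refine Fintype.sum_equiv (Equiv.mulRight ρ) _ _ fun π => ?_
  have h : ((sign ρ : ℤ) : B) * ((sign ρ : ℤ) : B) = 1 := by
    rcases Int.units_eq_one_or (sign ρ) with h | h <;> simp [h]
  simp only [Equiv.coe_mulRight, Equiv.Perm.sign_mul, Units.val_mul, Int.cast_mul,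
    Equiv.Perm.coe_mul, Function.comp_assoc]
  linear_combination (-((sign π : ℤ) : B) * f (x ∘ π ∘ ρ)) * h

/-- Antisymmetrising over a block of the arguments first changes nothing but a factor. -/
theorem sum_altSum_comp {ι κ X B : Type*} [Fintype ι] [DecidableEq ι] [Fintype κ]
    [DecidableEq κ] [CommRing B] (f : (ι → X) → B) (j : Equiv.Perm κ → Equiv.Perm ι) (hj : ∀ ρ, sign (j ρ) = sign ρ)
    (x : ι → X) :
    ∑ ρ, ((sign ρ : ℤ) : B) * altSum (fun y => f (y ∘ j ρ)) x =
      ((Fintype.card κ).factorial : B) * altSum f x := by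
  have h (ρ : Equiv.Perm κ) :
      ((sign ρ : ℤ) : B) * altSum (fun y => f (y ∘ j ρ)) x = altSum f x := by
    rw [altSum_comp_perm, hj]
    rcases Int.units_eq_one_or (sign ρ) with h | h <;> simp [h]
  rw [sum_congr rfl fun ρ _ => h ρ, sum_const, card_univ, Fintype.card_perm, nsmul_eq_mul]

theorem factorial_mul_cast_ne_zero (B : Type*) [Semiring B] [CharZero B] (m n : ℕ) :
    ((m.factorial * n.factorial : ℕ) : B) ≠ 0 :=
  Nat.cast_ne_zero.2 (Nat.mul_ne_zero m.factorial_ne_zero n.factorial_ne_zero)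

variable {B : Type*} [CommRing B] [Algebra ℝ B]

theorem factorial_mul_wedge {m n : ℕ} (σ : V [⋀^Fin m]→ₗ[ℝ] B) (τ : V [⋀^Fin n]→ₗ[ℝ] B)
    (x : Fin (m + n) → V) :
    ((m.factorial * n.factorial : ℕ) : B) * wedge σ τ x =
      altSum (fun y => σ (y ∘ Fin.castAdd n) * τ (y ∘ Fin.natAdd m)) x := by
  have h := congrArg (fun F => LinearMap.mul' ℝ B (F (x ∘ finSumFinEquiv)))
    (MultilinearMap.domCoprod_alternization_eq σ τ)
  simp only [Fintype.card_fin, AlternatingMap.smul_apply, map_nsmul,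
    MultilinearMap.alternatization_apply, map_sum] at h
  rw [nsmul_eq_mul] at h
  refine h.symm.trans ?_
  unfold altSum
  refine Fintype.sum_equiv (finSumFinEquiv.permCongr) _ _ fun π => ?_
  rw [Equiv.Perm.sign_permCongr, Units.smul_def, map_zsmul, zsmul_eq_mul]
  congr 1
  simp [MultilinearMap.domDomCongr_apply, MultilinearMap.domCoprod_apply, Function.comp_def]

/-- A transvection acts on a two-form by adding the derivation `t • v ∧ ι_u`. -/
theorem compLinearMap_transvection_two (σ : V [⋀^Fin 2]→ₗ[ℝ] B) (v : V →ₗ[ℝ] ℝ)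
    (α : V [⋀^Fin 1]→ₗ[ℝ] B) (hα : ∀ x, α x = algebraMap ℝ B (v (x 0))) (u : V) (t : ℝ) :
    σ.compLinearMap (LinearMap.transvection v (t • u)) =
      σ + t • (wedge α (σ.curryLeft u) : V [⋀^Fin 2]→ₗ[ℝ] B) := by
  ext x
  have h := factorial_mul_wedge α (σ.curryLeft u) x
  have hu : (univ : Finset (Equiv.Perm (Fin (1 + 1)))) = {1, Equiv.swap 0 1} := by decide
  have hs : (1 : Equiv.Perm (Fin (1 + 1))) ∉ ({Equiv.swap 0 1} : Finset _) := by decide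
  have h1 : x ∘ Fin.natAdd 1 = ![x 1] := by funext i; fin_cases i; rfl
  have h2 : (x ∘ Equiv.swap 0 1) ∘ Fin.natAdd 1 = ![x 0] := by
    funext i; fin_cases i; exact congrArg x (by decide)
  have hx : x = ![x 0, x 1] := by funext i; fin_cases i <;> rfl
  rw [altSum, hu, sum_insert hs, sum_singleton] at h
  simp [hα, h1, h2] at h
  have hz (a : V) : σ ![a, a] = 0 := σ.map_eq_zero_of_eq _ (i := 0) (j := 1) rfl (by decide)
  have hadd1 (a b c : V) : σ ![a + b, c] = σ ![a, c] + σ ![b, c] := σ.map_vecCons_add ![c] a b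
  have hadd2 (a b c : V) : σ ![a, b + c] = σ ![a, b] + σ ![a, c] :=
    (σ.curryLeft a).map_vecCons_add ![] b c
  have hsm1 (r : ℝ) (a c : V) : σ ![r • a, c] = r • σ ![a, c] := σ.map_vecCons_smul ![c] r a
  have hsm2 (r : ℝ) (a c : V) : σ ![a, r • c] = r • σ ![a, c] :=
    (σ.curryLeft a).map_vecCons_smul ![] r c
  have hsw (a b : V) : σ ![a, b] = - σ ![b, a] := by
    have := hz (a + b)
    rw [hadd1, hadd2, hadd2, hz, hz] at this
    linear_combination this
  have hg : (fun i => LinearMap.transvection v (t • u) (x i)) =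
      ![x 0 + v (x 0) • t • u, x 1 + v (x 1) • t • u] := by
    funext i; fin_cases i <;> rfl
  rw [AlternatingMap.compLinearMap_apply, AlternatingMap.add_apply, AlternatingMap.smul_apply, h,
    hg, show σ x = σ ![x 0, x 1] from congrArg σ hx]
  simp only [hadd1, hadd2, hsm1, hsm2, hz, Algebra.smul_def]
  rw [hsw (x 0) u]
  ring

variable [IsDomain B] [CharZero B]

/-- Two forms agree once their values agree after multiplication by `m! * n!`. -/
theorem wedge_ext {m n : ℕ} {σ τ : V [⋀^Fin (m + n)]→ₗ[ℝ] B}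
    (h : ∀ x, ((m.factorial * n.factorial : ℕ) : B) * σ x =
      ((m.factorial * n.factorial : ℕ) : B) * τ x) : σ = τ :=
  AlternatingMap.ext fun x => mul_left_cancel₀ (factorial_mul_cast_ne_zero B m n) (h x)

theorem wedge_add_left {m n : ℕ} (σ σ' : V [⋀^Fin m]→ₗ[ℝ] B) (τ : V [⋀^Fin n]→ₗ[ℝ] B) :
    wedge (σ + σ') τ = wedge σ τ + wedge σ' τ :=
  wedge_ext fun x => by
    simp only [AlternatingMap.add_apply, mul_add, factorial_mul_wedge, altSum, add_mul,
      sum_add_distrib]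

theorem wedge_add_right {m n : ℕ} (σ : V [⋀^Fin m]→ₗ[ℝ] B) (τ τ' : V [⋀^Fin n]→ₗ[ℝ] B) :
    wedge σ (τ + τ') = wedge σ τ + wedge σ τ' :=
  wedge_ext fun x => by
    simp only [AlternatingMap.add_apply, mul_add, factorial_mul_wedge, altSum,
      sum_add_distrib]

theorem wedge_smul_left {m n : ℕ} (t : ℝ) (σ : V [⋀^Fin m]→ₗ[ℝ] B) (τ : V [⋀^Fin n]→ₗ[ℝ] B) :
    wedge (t • σ) τ = t • wedge σ τ :=
  wedge_ext fun x => by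
    simp only [AlternatingMap.smul_apply, mul_smul_comm, factorial_mul_wedge, altSum,
      smul_mul_assoc, smul_sum]

theorem wedge_smul_right {m n : ℕ} (t : ℝ) (σ : V [⋀^Fin m]→ₗ[ℝ] B) (τ : V [⋀^Fin n]→ₗ[ℝ] B) :
    wedge σ (t • τ) = t • wedge σ τ :=
  wedge_ext fun x => by
    simp only [AlternatingMap.smul_apply, mul_smul_comm, factorial_mul_wedge, altSum,
      smul_sum]

theorem wedge_add_smul_apply {m n : ℕ} (σ σ' : V [⋀^Fin m]→ₗ[ℝ] B) (τ τ' : V [⋀^Fin n]→ₗ[ℝ] B)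
    (t : ℝ) (x : Fin (m + n) → V) :
    wedge (σ + t • σ') (τ + t • τ') x = wedge σ τ x + algebraMap ℝ B t * wedge σ' τ x +
      algebraMap ℝ B t * (wedge σ τ' x + algebraMap ℝ B t * wedge σ' τ' x) := by
  simp only [wedge_add_left, wedge_add_right, wedge_smul_left, wedge_smul_right,
    AlternatingMap.add_apply, AlternatingMap.smul_apply, Algebra.smul_def]

theorem wedge_compLinearMap {m n : ℕ} (σ : V [⋀^Fin m]→ₗ[ℝ] B) (τ : V [⋀^Fin n]→ₗ[ℝ] B)
    (g : V →ₗ[ℝ] V) :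
    wedge (σ.compLinearMap g) (τ.compLinearMap g) = (wedge σ τ).compLinearMap g :=
  wedge_ext fun x => by
    rw [AlternatingMap.compLinearMap_apply]
    simp only [factorial_mul_wedge, altSum]
    rfl

theorem factorial_mul_wedge_wedge_right {m n p : ℕ} (σ : V [⋀^Fin m]→ₗ[ℝ] B)
    (τ : V [⋀^Fin n]→ₗ[ℝ] B) (ρ : V [⋀^Fin p]→ₗ[ℝ] B) (x : Fin (m + (n + p)) → V) :
    ((m.factorial * (n.factorial * p.factorial) : ℕ) : B) * wedge σ (wedge τ ρ) x =
      altSum (fun y => σ (y ∘ Fin.castAdd (n + p)) *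
        (τ ((y ∘ Fin.natAdd m) ∘ Fin.castAdd p) * ρ ((y ∘ Fin.natAdd m) ∘ Fin.natAdd n))) x := by
  have hc : (((n + p).factorial : ℕ) : B) ≠ 0 := Nat.cast_ne_zero.2 (Nat.factorial_ne_zero _)
  apply mul_left_cancel₀ hc
  have key := sum_altSum_comp (fun y : Fin (m + (n + p)) → V => σ (y ∘ Fin.castAdd (n + p)) *
        (τ ((y ∘ Fin.natAdd m) ∘ Fin.castAdd p) * ρ ((y ∘ Fin.natAdd m) ∘ Fin.natAdd n)))
      (fun κ : Equiv.Perm (Fin (n + p)) =>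
        finSumFinEquiv.permCongr (Equiv.Perm.sumCongr 1 κ)) (by simp) x
  rw [Fintype.card_fin] at key
  rw [← key]
  have h := factorial_mul_wedge σ (wedge τ ρ) x
  have h1 : ((n + p).factorial : B) *
      (((m.factorial * (n.factorial * p.factorial) : ℕ) : B) * wedge σ (wedge τ ρ) x) =
      ((n.factorial * p.factorial : ℕ) : B) *
        (((m.factorial * (n + p).factorial : ℕ) : B) * wedge σ (wedge τ ρ) x) := by
    push_cast; ring
  rw [h1, h]
  simp only [altSum, mul_sum]
  rw [sum_comm]
  refine sum_congr rfl fun π _ => ?_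
  have h2 := factorial_mul_wedge τ ρ ((x ∘ π) ∘ Fin.natAdd m)
  have h3 : ∀ a b c d : B, a * (b * (c * d)) = b * (c * (a * d)) := fun a b c d => by ring
  rw [h3, h2, altSum, mul_sum, mul_sum]
  refine sum_congr rfl fun κ _ => ?_
  have hl : ((x ∘ π) ∘ finSumFinEquiv.permCongr (Equiv.Perm.sumCongr 1 κ)) ∘ Fin.castAdd (n + p) =
      (x ∘ π) ∘ Fin.castAdd (n + p) := by
    funext i; simp
  have hr : ((x ∘ π) ∘ finSumFinEquiv.permCongr (Equiv.Perm.sumCongr 1 κ)) ∘ Fin.natAdd m =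
      ((x ∘ π) ∘ Fin.natAdd m) ∘ κ := by
    funext i; simp
  rw [hl, hr]
  ring

theorem factorial_mul_wedge_wedge_left {m n p : ℕ} (σ : V [⋀^Fin m]→ₗ[ℝ] B)
    (τ : V [⋀^Fin n]→ₗ[ℝ] B) (ρ : V [⋀^Fin p]→ₗ[ℝ] B) (x : Fin (m + n + p) → V) :
    ((m.factorial * (n.factorial * p.factorial) : ℕ) : B) * wedge (wedge σ τ) ρ x =
      altSum (fun y => σ ((y ∘ Fin.castAdd p) ∘ Fin.castAdd n) *
        (τ ((y ∘ Fin.castAdd p) ∘ Fin.natAdd m) * ρ (y ∘ Fin.natAdd (m + n)))) x := by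
  have hc : (((m + n).factorial : ℕ) : B) ≠ 0 := Nat.cast_ne_zero.2 (Nat.factorial_ne_zero _)
  apply mul_left_cancel₀ hc
  have key := sum_altSum_comp (fun y : Fin (m + n + p) → V =>
      σ ((y ∘ Fin.castAdd p) ∘ Fin.castAdd n) *
        (τ ((y ∘ Fin.castAdd p) ∘ Fin.natAdd m) * ρ (y ∘ Fin.natAdd (m + n))))
      (fun κ : Equiv.Perm (Fin (m + n)) =>
        finSumFinEquiv.permCongr (Equiv.Perm.sumCongr κ 1)) (by simp) x
  rw [Fintype.card_fin] at key
  rw [← key]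
  have h := factorial_mul_wedge (wedge σ τ) ρ x
  have h1 : ((m + n).factorial : B) *
      (((m.factorial * (n.factorial * p.factorial) : ℕ) : B) * wedge (wedge σ τ) ρ x) =
      ((m.factorial * n.factorial : ℕ) : B) *
        ((((m + n).factorial * p.factorial : ℕ) : B) * wedge (wedge σ τ) ρ x) := by
    push_cast; ring
  rw [h1, h]
  simp only [altSum, mul_sum]
  rw [sum_comm]
  refine sum_congr rfl fun π _ => ?_
  have h2 := factorial_mul_wedge σ τ ((x ∘ π) ∘ Fin.castAdd p)
  have h3 : ∀ a b c d : B, a * (b * (c * d)) = b * (d * (a * c)) := fun a b c d => by ring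
  rw [h3, h2, altSum, mul_sum, mul_sum]
  refine sum_congr rfl fun κ _ => ?_
  have hl : ((x ∘ π) ∘ finSumFinEquiv.permCongr (Equiv.Perm.sumCongr κ 1)) ∘ Fin.natAdd (m + n) =
      (x ∘ π) ∘ Fin.natAdd (m + n) := by
    funext i; simp
  have hr : ((x ∘ π) ∘ finSumFinEquiv.permCongr (Equiv.Perm.sumCongr κ 1)) ∘ Fin.castAdd p =
      ((x ∘ π) ∘ Fin.castAdd p) ∘ κ := by
    funext i; simp
  rw [hl, hr]
  ring

/-- Associativity of the wedge product in the degrees `(1, 1, 4)`. -/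
theorem wedge_assoc_one_one_four (σ τ : V [⋀^Fin 1]→ₗ[ℝ] B) (ρ : V [⋀^Fin 4]→ₗ[ℝ] B) :
    (wedge σ (wedge τ ρ) : V [⋀^Fin 6]→ₗ[ℝ] B) = wedge (wedge σ τ) ρ := by
  ext x
  have hl := factorial_mul_wedge_wedge_left σ τ ρ x
  have hr := factorial_mul_wedge_wedge_right σ τ ρ x
  refine mul_left_cancel₀ ?_ (hr.trans (Eq.trans ?_ hl.symm))
  · exact Nat.cast_ne_zero.2 (by decide)
  · congr 1
    funext y
    have h : (y ∘ Fin.natAdd 1) ∘ Fin.natAdd 1 = y ∘ Fin.natAdd (1 + 1) := by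
      funext i; fin_cases i <;> rfl
    exact congrArg (fun z => σ _ * (τ _ * ρ z)) h

theorem wedge_three_three_comm (σ τ : V [⋀^Fin 3]→ₗ[ℝ] B) : wedge σ τ = -wedge τ σ :=
  wedge_ext fun x => by
    rw [AlternatingMap.neg_apply, mul_neg, factorial_mul_wedge, factorial_mul_wedge]
    let ρ : Equiv.Perm (Fin (3 + 3)) :=
      Equiv.swap 0 3 * Equiv.swap 1 4 * Equiv.swap 2 5
    have hρ : sign ρ = -1 := by decide
    have h := altSum_comp_perm
      (fun y : Fin (3 + 3) → V => τ (y ∘ Fin.castAdd 3) * σ (y ∘ Fin.natAdd 3)) ρ x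
    rw [hρ] at h
    simp only [Units.val_neg, Units.val_one, Int.cast_neg, Int.cast_one, neg_mul, one_mul] at h
    rw [← h]
    congr 1
    funext y
    have h1 : (y ∘ ρ) ∘ Fin.castAdd 3 = y ∘ Fin.natAdd 3 := by
      funext i; fin_cases i <;> exact congrArg y (by decide)
    have h2 : (y ∘ ρ) ∘ Fin.natAdd 3 = y ∘ Fin.castAdd 3 := by
      funext i; fin_cases i <;> exact congrArg y (by decide)
    rw [h1, h2, mul_comm]

theorem wedge_two_two_comm (σ τ : V [⋀^Fin 2]→ₗ[ℝ] B) : wedge σ τ = wedge τ σ :=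
  wedge_ext fun x => by
    rw [factorial_mul_wedge, factorial_mul_wedge]
    let ρ : Equiv.Perm (Fin (2 + 2)) := Equiv.swap 0 2 * Equiv.swap 1 3
    have hρ : sign ρ = 1 := by decide
    have h := altSum_comp_perm
      (fun y : Fin (2 + 2) → V => τ (y ∘ Fin.castAdd 2) * σ (y ∘ Fin.natAdd 2)) ρ x
    rw [hρ] at h
    simp only [Units.val_one, Int.cast_one, one_mul] at h
    rw [← h]
    congr 1
    funext y
    have h1 : (y ∘ ρ) ∘ Fin.castAdd 2 = y ∘ Fin.natAdd 2 := by
      funext i; fin_cases i <;> exact congrArg y (by decide)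
    have h2 : (y ∘ ρ) ∘ Fin.natAdd 2 = y ∘ Fin.castAdd 2 := by
      funext i; fin_cases i <;> exact congrArg y (by decide)
    rw [h1, h2, mul_comm]

theorem wedge_two_two_two_left_comm (α β γ : V [⋀^Fin 2]→ₗ[ℝ] B) :
    wedge α (wedge β γ) = wedge β (wedge α γ) := by
  ext x
  have hl := factorial_mul_wedge_wedge_right α β γ x
  have hr := factorial_mul_wedge_wedge_right β α γ x
  refine mul_left_cancel₀ ?_ (hl.trans (Eq.trans ?_ hr.symm))
  · exact Nat.cast_ne_zero.2 (by decide)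
  let ρ : Equiv.Perm (Fin (2 + (2 + 2))) := Equiv.swap 0 2 * Equiv.swap 1 3
  have hρ : sign ρ = 1 := by decide
  have h := altSum_comp_perm
    (fun y : Fin (2 + (2 + 2)) → V => β (y ∘ Fin.castAdd (2 + 2)) *
      (α ((y ∘ Fin.natAdd 2) ∘ Fin.castAdd 2) * γ ((y ∘ Fin.natAdd 2) ∘ Fin.natAdd 2))) ρ x
  rw [hρ] at h
  simp only [Units.val_one, Int.cast_one, one_mul] at h
  rw [← h]
  congr 1
  funext y
  have h1 : (y ∘ ρ) ∘ Fin.castAdd (2 + 2) = (y ∘ Fin.natAdd 2) ∘ Fin.castAdd 2 := by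
    funext i; fin_cases i <;> exact congrArg y (by decide)
  have h2 : ((y ∘ ρ) ∘ Fin.natAdd 2) ∘ Fin.castAdd 2 = y ∘ Fin.castAdd (2 + 2) := by
    funext i; fin_cases i <;> exact congrArg y (by decide)
  have h3 : ((y ∘ ρ) ∘ Fin.natAdd 2) ∘ Fin.natAdd 2 = (y ∘ Fin.natAdd 2) ∘ Fin.natAdd 2 := by
    funext i; fin_cases i <;> exact congrArg y (by decide)
  rw [h1, h2, h3]
  ring

theorem compLinearMap_transvection_three (σ : V [⋀^Fin 3]→ₗ[ℝ] B) (v : V →ₗ[ℝ] ℝ)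
    (α : V [⋀^Fin 1]→ₗ[ℝ] B) (hα : ∀ x, α x = algebraMap ℝ B (v (x 0))) (u : V) (t : ℝ) :
    σ.compLinearMap (LinearMap.transvection v (t • u)) =
      σ + t • (wedge α (σ.curryLeft u) : V [⋀^Fin 3]→ₗ[ℝ] B) := by
  ext x
  have h := factorial_mul_wedge α (σ.curryLeft u) x
  have hu : (univ : Finset (Equiv.Perm (Fin (1 + 2)))) =
      {1, Equiv.swap 0 1, Equiv.swap 0 2, Equiv.swap 1 2, Equiv.swap 0 1 * Equiv.swap 1 2,
        Equiv.swap 1 2 * Equiv.swap 0 1} := by decide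
  have hx : x = ![x 0, x 1, x 2] := by funext i; fin_cases i <;> rfl
  have hterm (π : Equiv.Perm (Fin (1 + 2))) :
      α ((x ∘ π) ∘ Fin.castAdd 2) * σ.curryLeft u ((x ∘ π) ∘ Fin.natAdd 1) =
        algebraMap ℝ B (v (x (π 0))) * σ ![u, x (π 1), x (π 2)] := by
    rw [hα, AlternatingMap.curryLeft_apply_apply]
    congr 2
    funext i; fin_cases i <;> rfl
  rw [altSum, hu] at h
  rw [sum_insert (by decide), sum_insert (by decide), sum_insert (by decide),
    sum_insert (by decide), sum_insert (by decide), sum_singleton] at h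
  simp only [hterm] at h
  have hz1 (a b : V) : σ ![a, a, b] = 0 :=
    σ.map_eq_zero_of_eq _ (i := 0) (j := 1) rfl (by decide)
  have hz2 (a b : V) : σ ![b, a, a] = 0 :=
    σ.map_eq_zero_of_eq _ (i := 1) (j := 2) rfl (by decide)
  have hz3 (a b : V) : σ ![a, b, a] = 0 :=
    σ.map_eq_zero_of_eq _ (i := 0) (j := 2) rfl (by decide)
  have hadd1 (a b c d : V) : σ ![a + b, c, d] = σ ![a, c, d] + σ ![b, c, d] :=
    σ.map_vecCons_add ![c, d] a b
  have hadd2 (a b c d : V) : σ ![a, b + c, d] = σ ![a, b, d] + σ ![a, c, d] :=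
    (σ.curryLeft a).map_vecCons_add ![d] b c
  have hadd3 (a b c d : V) : σ ![a, b, c + d] = σ ![a, b, c] + σ ![a, b, d] :=
    ((σ.curryLeft a).curryLeft b).map_vecCons_add ![] c d
  have hsm1 (r : ℝ) (a b c : V) : σ ![r • a, b, c] = r • σ ![a, b, c] :=
    σ.map_vecCons_smul ![b, c] r a
  have hsm2 (r : ℝ) (a b c : V) : σ ![a, r • b, c] = r • σ ![a, b, c] :=
    (σ.curryLeft a).map_vecCons_smul ![c] r b
  have hsm3 (r : ℝ) (a b c : V) : σ ![a, b, r • c] = r • σ ![a, b, c] :=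
    ((σ.curryLeft a).curryLeft b).map_vecCons_smul ![] r c
  have hsw12 (a b c : V) : σ ![a, b, c] = - σ ![b, a, c] := by
    have := hz1 (a + b) c
    rw [hadd1, hadd2, hadd2, hz1, hz1] at this
    linear_combination this
  have hsw23 (a b c : V) : σ ![a, b, c] = - σ ![a, c, b] := by
    have := hz2 (b + c) a
    rw [hadd2, hadd3, hadd3, hz2, hz2] at this
    linear_combination this
  have hg : (fun i => LinearMap.transvection v (t • u) (x i)) =
      ![x 0 + v (x 0) • t • u, x 1 + v (x 1) • t • u, x 2 + v (x 2) • t • u] := by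
    funext i; fin_cases i <;> rfl
  have hW : wedge α (σ.curryLeft u) x = algebraMap ℝ B (v (x 0)) * σ ![u, x 1, x 2] -
      algebraMap ℝ B (v (x 1)) * σ ![u, x 0, x 2] +
      algebraMap ℝ B (v (x 2)) * σ ![u, x 0, x 1] := by
    have s1 : sign (Equiv.swap (0 : Fin (1 + 2)) 1) = -1 := by decide
    have s2 : sign (Equiv.swap (0 : Fin (1 + 2)) 2) = -1 := by decide
    have s3 : sign (Equiv.swap (1 : Fin (1 + 2)) 2) = -1 := by decide
    have p1 : (Equiv.swap (0 : Fin (1 + 2)) 1) 2 = 2 := by decide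
    have p2 : (Equiv.swap (0 : Fin (1 + 2)) 2) 1 = 1 := by decide
    have p3 : (Equiv.swap (1 : Fin (1 + 2)) 2) 0 = 0 := by decide
    simp only [Equiv.Perm.sign_mul, s1, s2, s3, Equiv.Perm.coe_mul, Function.comp_apply, p1, p2, p3,
      Equiv.swap_apply_left, Equiv.swap_apply_right, Equiv.Perm.coe_one, id_eq, Equiv.Perm.sign_one] at h
    rw [hsw23 u (x 1) (x 0), hsw23 u (x 2) (x 1), hsw23 u (x 2) (x 0)] at h
    norm_num at h
    have h2 : (2 : B) ≠ 0 := two_ne_zero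
    refine mul_left_cancel₀ h2 ?_
    linear_combination h
  rw [AlternatingMap.compLinearMap_apply, AlternatingMap.add_apply, AlternatingMap.smul_apply, hW,
    hg, show σ x = σ ![x 0, x 1, x 2] from congrArg σ hx]
  simp only [hadd1, hadd2, hadd3, hsm1, hsm2, hsm3, hz1, hz2, hz3, Algebra.smul_def]
  rw [hsw12 (x 0) u, hsw23 (x 0) (x 1) u, hsw12 (x 0) u]
  ring

theorem compLinearMap_transvection_top [FiniteDimensional ℝ V] {n : ℕ}
    (hdim : Module.finrank ℝ V = n) (σ : V [⋀^Fin n]→ₗ[ℝ] ℝ) (v : V →ₗ[ℝ] ℝ) (u : V) (t : ℝ) :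
    σ.compLinearMap (LinearMap.transvection v (t • u)) = (1 + t * v u) • σ := by
  have e := Module.finBasisOfFinrankEq ℝ V hdim
  rw [σ.eq_smul_basis_det e]
  ext x
  have h := Module.Basis.det_comp e (LinearMap.transvection v (t • u)) x
  rw [LinearMap.transvection.det, map_smul, smul_eq_mul] at h
  simp only [AlternatingMap.compLinearMap_apply, AlternatingMap.smul_apply, smul_eq_mul]
  rw [show (fun i => LinearMap.transvection v (t • u) (x i)) =
    LinearMap.transvection v (t • u) ∘ x from rfl, h]
  ring

/-- On a top-degree cube of a two-form, `v ∧ ι_u` acts as a derivation and as `v u`. -/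
theorem three_smul_wedge_curryLeft [FiniteDimensional ℝ V] (hdim : Module.finrank ℝ V = 6)
    (ω : V [⋀^Fin 2]→ₗ[ℝ] ℝ) (v : V →ₗ[ℝ] ℝ) (α : V [⋀^Fin 1]→ₗ[ℝ] ℝ)
    (hα : ∀ x, α x = v (x 0)) (u : V) :
    (3 : ℝ) • wedge (wedge α (ω.curryLeft u) : V [⋀^Fin 2]→ₗ[ℝ] ℝ) (wedge ω ω) =
      v u • wedge ω (wedge ω ω) := by
  set δ : V [⋀^Fin 2]→ₗ[ℝ] ℝ := wedge α (ω.curryLeft u) with hδ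
  have key (t : ℝ) : wedge (ω + t • δ) (wedge (ω + t • δ) (ω + t • δ)) =
      (1 + t * v u) • wedge ω (wedge ω ω) := by
    rw [← compLinearMap_transvection_two ω v α hα u t, wedge_compLinearMap, wedge_compLinearMap]
    have h := compLinearMap_transvection_top (n := 2 + (2 + 2)) hdim (wedge ω (wedge ω ω)) v u t
    rw [h]
  simp only [wedge_add_left, wedge_add_right, wedge_smul_left, wedge_smul_right] at key
  rw [wedge_two_two_comm ω δ, wedge_two_two_two_left_comm ω δ ω,
    wedge_two_two_two_left_comm ω δ δ, wedge_two_two_comm ω δ] at key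
  ext x
  have k1 := congrArg (fun F => F x) (key 1)
  have k2 := congrArg (fun F => F x) (key (-1))
  have k3 := congrArg (fun F => F x) (key 2)
  have k4 := congrArg (fun F => F x) (key (-2))
  simp only [AlternatingMap.add_apply, AlternatingMap.smul_apply, smul_eq_mul] at k1 k2 k3 k4 ⊢
  generalize wedge ω (wedge ω ω) x = a at *
  generalize wedge δ (wedge ω ω) x = b at *
  generalize wedge δ (wedge δ ω) x = c at *
  generalize wedge δ (wedge δ δ) x = d at *
  generalize wedge ω (wedge δ δ) x = e at *
  linarith

end Wedge

theorem conjA_compLinearMap {n : ℕ} (σ : V [⋀^Fin n]→ₗ[ℝ] ℂ) (g : V →ₗ[ℝ] V) :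
    conjA (σ.compLinearMap g) = (conjA σ).compLinearMap g := rfl

theorem conjA_wedge {m n : ℕ} (σ : V [⋀^Fin m]→ₗ[ℝ] ℂ) (τ : V [⋀^Fin n]→ₗ[ℝ] ℂ) :
    conjA (wedge σ τ) = wedge (conjA σ) (conjA τ) :=
  wedge_ext fun x => by
    have h := congrArg (starRingEnd ℂ) (factorial_mul_wedge σ τ x)
    rw [map_mul, map_natCast] at h
    rw [factorial_mul_wedge]
    refine h.trans ?_
    simp only [altSum, map_sum, map_mul, map_intCast]
    rfl


/-- Comparing the first-order terms of `Ω ∧ Ω̄` and `ω³` along transvections `g t`. -/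
theorem two_mul_re_eq_of_top_form {n : ℕ} {W : V [⋀^Fin n]→ₗ[ℝ] ℝ} (hW : W ≠ 0)
    {S A A' D : V [⋀^Fin n]→ₗ[ℝ] ℂ} {g : ℝ → V →ₗ[ℝ] V} {c k : ℝ} {P : ℂ}
    (hS : ((6 : ℂ) * Complex.I) • S = c • toC W) (hA : ((6 : ℂ) * Complex.I) • A = P • toC W)
    (hA' : conjA A = -A')
    (hg : ∀ (t : ℝ) x, S.compLinearMap (g t) x = S x + t * A x + t * (A' x + t * D x))
    (hgW : ∀ t, W.compLinearMap (g t) = (1 + t * k) • W) : 2 * P.re = c * k := by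
  obtain ⟨x, hx⟩ : ∃ x, W x ≠ 0 := by
    by_contra! h
    exact hW (AlternatingMap.ext h)
  have hSx (t : ℝ) := congrArg (fun F => F fun i => g t (x i)) hS
  have hAx := congrArg (fun F => F x) hA
  have hAx' := congrArg (fun F => F x) hA'
  have hgx (t : ℝ) := hg t x
  have hgWx (t : ℝ) := congrArg (fun F => F x) (hgW t)
  simp only [conjA, toC, LinearMap.compAlternatingMap_apply, AlternatingMap.smul_apply,
    AlternatingMap.compLinearMap_apply, AlternatingMap.neg_apply] at hSx hAx hAx' hgx hgWx
  have h1 := hSx 1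
  have h2 := hSx (-1)
  rw [hgx, hgWx] at h1 h2
  have e1 := congrArg Complex.re h1
  have e2 := congrArg Complex.re h2
  have e3 := congrArg Complex.re hAx
  have e4 := congrArg Complex.im hAx'
  simp at e1 e2 e3 e4
  apply mul_right_cancel₀ hx
  linarith

/-- pointwise, on a 6-dimensional space: let `ω` be a positive `(1,1)`-form,
`Ω` a nonzero `(3,0)`-form with `6iΩ∧Ω̄ = ‖Ω‖²ω³` (`N = ‖Ω‖ > 0`), `v` a nonzero real
covector, `V` a vector with `Ω̇ = v∧ι_VΩ`, and `ω̇` a real 2-form.  If the variation of the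
norm vanishes, `δ(‖Ω‖_ω) = N⁻¹ Re P − ½ N L = 0` (with `6iΩ̇∧Ω̄ = Pω³`, `3ω̇∧ω² = Lω³`),
then `ω̇∧ω² = v∧(ι_Vω)∧ω²`. -/
theorem statement15
    [FiniteDimensional ℝ V] (hdim : Module.finrank ℝ V = 6)
    (ω : V [⋀^Fin 2]→ₗ[ℝ] ℝ) (Ω : V [⋀^Fin 3]→ₗ[ℝ] ℂ) (hΩne : Ω ≠ 0)
    (v : V →ₗ[ℝ] ℝ) (hv : v ≠ 0) (Vv : V)
    (ωdot : V [⋀^Fin 2]→ₗ[ℝ] ℝ)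
    (Ωdot : V [⋀^Fin 3]→ₗ[ℝ] ℂ)
    (hΩdot : Ωdot = wedge (toC ((AlternatingMap.ofSubsingleton ℝ V ℝ (0 : Fin 1)) v))
      (Ω.curryLeft Vv))
    (N : ℝ) (hN : 0 < N)
    (hω3ne : wedge ω (wedge ω ω) ≠ 0)
    (hnorm : ((6 : ℂ) * Complex.I) • wedge Ω (conjA Ω)
      = (N ^ 2) • toC (wedge ω (wedge ω ω)))
    (P : ℂ)
    (hP : ((6 : ℂ) * Complex.I) • wedge Ωdot (conjA Ω) = P • toC (wedge ω (wedge ω ω)))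
    (L : ℝ)
    (hL : (3 : ℝ) • wedge ωdot (wedge ω ω) = L • wedge ω (wedge ω ω))
    (hδ : N⁻¹ * P.re - (1 / 2) * N * L = 0) :
    wedge ωdot (wedge ω ω)
      = wedge ((AlternatingMap.ofSubsingleton ℝ V ℝ (0 : Fin 1)) v)
          (wedge (ω.curryLeft Vv) (wedge ω ω)) := by
  set α : V [⋀^Fin 1]→ₗ[ℝ] ℝ := AlternatingMap.ofSubsingleton ℝ V ℝ (0 : Fin 1) v with hα
  have hα0 (x : Fin 1 → V) : α x = v (x 0) := rfl
  have hA : wedge α (wedge (ω.curryLeft Vv) (wedge ω ω)) =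
      wedge (wedge α (ω.curryLeft Vv) : V [⋀^Fin 2]→ₗ[ℝ] ℝ) (wedge ω ω) :=
    wedge_assoc_one_one_four α (ω.curryLeft Vv) (wedge ω ω)
  have hD := three_smul_wedge_curryLeft hdim ω v α hα0 Vv
  have hΩ (t : ℝ) : Ω.compLinearMap (LinearMap.transvection v (t • Vv)) = Ω + t • Ωdot := by
    rw [hΩdot]
    exact compLinearMap_transvection_three Ω v (toC α) (fun _ => rfl) Vv t
  have hΩ' (t : ℝ) : (conjA Ω).compLinearMap (LinearMap.transvection v (t • Vv)) =
      conjA Ω + t • conjA Ωdot := by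
    rw [← conjA_compLinearMap, hΩ]
    ext x
    simp [conjA]
  have hconj : conjA (wedge Ωdot (conjA Ω)) = -wedge Ω (conjA Ωdot) := by
    rw [conjA_wedge, wedge_three_three_comm]
    congr 2
    ext x
    simp [conjA]
  have hE (t : ℝ) (x) := wedge_add_smul_apply Ω Ωdot (conjA Ω) (conjA Ωdot) t x
  simp only [← hΩ, ← hΩ', wedge_compLinearMap] at hE
  have htop (t : ℝ) :=
    compLinearMap_transvection_top (n := 2 + (2 + 2)) hdim (wedge ω (wedge ω ω)) v Vv t
  have hPk : 2 * P.re = N ^ 2 * v Vv :=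
    two_mul_re_eq_of_top_form (n := 3 + 3) hω3ne hnorm hP hconj hE htop
  have hLk : L = v Vv := by
    field_simp at hδ
    have : N ^ 2 * L = N ^ 2 * v Vv := by linarith
    exact mul_left_cancel₀ (pow_ne_zero 2 hN.ne') this
  rw [hA]
  refine smul_right_injective _ (three_ne_zero (α := ℝ)) ?_
  exact hL.trans (hLk ▸ hD.symm)

end Statement15
end
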